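/- Let ‖·‖_! be a symmetric anti-norm on the cone of n×n positive semidefinite complex matrices and let q ∈ (0,1). Then the functional A ↦ ‖A^q‖_!^{1/q} is again a symmetric anti-norm; in particular, for all positive semidefinite A, B one has ‖(A+B)^q‖_!^{1/q} ≥ ‖A^q‖_!^{1/q} + ‖B^q‖_!^{1/q}. -/

import Mathlib

open scoped Matrix ComplexOrder

/-- A symmetric anti-norm on the cone of `n×n` positive semidefinite complex matrices:
nonnegative, positively homogeneous, superadditive and unitarily invariant on the cone. -/
def IsSymmetricAntiNorm {k : Type*} [Fintype k] [DecidableEq k]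
    (N : Matrix k k ℂ → ℝ) : Prop :=
  (∀ A : Matrix k k ℂ, A.PosSemidef → 0 ≤ N A) ∧
  (∀ (c : ℝ), 0 ≤ c → ∀ A : Matrix k k ℂ, A.PosSemidef → N (c • A) = c * N A) ∧
  (∀ A B : Matrix k k ℂ, A.PosSemidef → B.PosSemidef → N A + N B ≤ N (A + B)) ∧
  (∀ (U A : Matrix k k ℂ), U ∈ Matrix.unitaryGroup k ℂ → A.PosSemidef →
    N (U * A * Uᴴ) = N A)

open scoped MatrixOrder Matrix.Norms.L2Operator in
/-- Operator concavity of `x ↦ x ^ q` on positive semidefinite matrices, for `q ∈ [0, 1]`. -/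
lemma Matrix.concaveOn_cfc_rpow {k : Type*} [Fintype k] [DecidableEq k] {q : ℝ}
    (hq : q ∈ Set.Icc (0 : ℝ) 1) :
    ConcaveOn ℝ (Set.Ici (0 : Matrix k k ℂ)) (cfc (fun x : ℝ => x ^ q)) :=
  (CFC.concaveOn_rpow (A := Matrix k k ℂ) hq).congr fun _ ha => CFC.rpow_eq_cfc_real ha

open scoped MatrixOrder Matrix.Norms.L2Operator in
/-- Operator monotonicity of `x ↦ x ^ q` on positive semidefinite matrices, for `q ∈ [0, 1]`. -/
lemma Matrix.monotoneOn_cfc_rpow {k : Type*} [Fintype k] [DecidableEq k] {q : ℝ}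
    (hq : q ∈ Set.Icc (0 : ℝ) 1) :
    MonotoneOn (cfc (fun x : ℝ => x ^ q)) (Set.Ici (0 : Matrix k k ℂ)) :=
  ((CFC.monotone_rpow (A := Matrix k k ℂ) hq).monotoneOn _).congr
    fun _ ha => CFC.rpow_eq_cfc_real ha

namespace Matrix.PosSemidef

variable {k : Type*} [Fintype k] [DecidableEq k] {A : Matrix k k ℂ} {q : ℝ}

open scoped MatrixOrder in
lemma cfc_rpow (hA : A.PosSemidef) (q : ℝ) : (cfc (fun x : ℝ => x ^ q) A).PosSemidef := by
  rw [← Matrix.nonneg_iff_posSemidef] at hA ⊢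
  exact cfc_nonneg fun x hx => Real.rpow_nonneg (spectrum_nonneg_of_nonneg hA hx) q

open scoped MatrixOrder in
lemma cfc_rpow_smul (hA : A.PosSemidef) (hq : 0 ≤ q) {c : ℝ} (hc : 0 ≤ c) :
    cfc (fun x : ℝ => x ^ q) (c • A) = c ^ q • cfc (fun x : ℝ => x ^ q) A := by
  have hcont (s : Set ℝ) : ContinuousOn (fun x : ℝ => x ^ q) s :=
    (Real.continuous_rpow_const hq).continuousOn
  have hA' : IsSelfAdjoint A := hA.isHermitian
  rw [← cfc_comp_smul c _ A (hcont _), ← cfc_smul _ _ A (hcont _)]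
  exact cfc_congr fun x hx => Real.mul_rpow hc
    (spectrum_nonneg_of_nonneg (Matrix.nonneg_iff_posSemidef.2 hA) hx)

lemma cfc_rpow_unitary_conj (hA : A.PosSemidef) (hq : 0 ≤ q) {U : Matrix k k ℂ}
    (hU : U ∈ Matrix.unitaryGroup k ℂ) :
    cfc (fun x : ℝ => x ^ q) (U * A * Uᴴ) = U * cfc (fun x : ℝ => x ^ q) A * Uᴴ := by
  have hA' : IsSelfAdjoint A := hA.isHermitian
  let φ := Unitary.conjStarAlgAut ℝ (Matrix k k ℂ) ⟨U, hU⟩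
  have hφ : Continuous φ := by
    change Continuous fun X : Matrix k k ℂ => U * X * star U
    fun_prop
  exact (StarAlgHomClass.map_cfc φ (fun x : ℝ => x ^ q) A
    (Real.continuous_rpow_const hq).continuousOn hφ hA' (hA'.map φ)).symm

end Matrix.PosSemidef

namespace IsSymmetricAntiNorm

variable {k : Type*} [Fintype k] [DecidableEq k] {N : Matrix k k ℂ → ℝ} {A B : Matrix k k ℂ}
  {q : ℝ}

open scoped MatrixOrder in
lemma mono (hN : IsSymmetricAntiNorm N) (hA : A.PosSemidef) (hAB : A ≤ B) : N A ≤ N B := by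
  have h := hN.2.2.1 A (B - A) hA hAB
  rw [add_sub_cancel] at h
  linarith [hN.1 (B - A) hAB]

open scoped MatrixOrder in
/-- If `A`, `B` are positive multiples `a • A'`, `b • B'` with `N (A' ^ q) = N (B' ^ q) = 1`, then
operator concavity at the convex combination `(a + b)⁻¹ • (A + B)` of `A'` and `B'` gives the
bound; otherwise it follows from operator monotonicity. -/
lemma rpow_superadditive (hN : IsSymmetricAntiNorm N) (hq0 : 0 < q) (hq1 : q ≤ 1)
    (hA : A.PosSemidef) (hB : B.PosSemidef) :
    N (cfc (fun x : ℝ => x ^ q) A) ^ (1 / q) + N (cfc (fun x : ℝ => x ^ q) B) ^ (1 / q) ≤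
      N (cfc (fun x : ℝ => x ^ q) (A + B)) ^ (1 / q) := by
  have hq : q ∈ Set.Icc (0 : ℝ) 1 := ⟨hq0.le, hq1⟩
  have hA0 : 0 ≤ A := Matrix.nonneg_iff_posSemidef.2 hA
  have hB0 : 0 ≤ B := Matrix.nonneg_iff_posSemidef.2 hB
  have hNA := hN.1 _ (hA.cfc_rpow q)
  have hNB := hN.1 _ (hB.cfc_rpow q)
  have hqinv : 0 ≤ 1 / q := by positivity
  rcases hNA.eq_or_lt with h0 | hNA'
  · rw [← h0, Real.zero_rpow (by positivity), zero_add]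
    exact Real.rpow_le_rpow hNB (hN.mono (hB.cfc_rpow q) (Matrix.monotoneOn_cfc_rpow hq hB0
      (add_nonneg hA0 hB0) (le_add_of_nonneg_left hA0))) hqinv
  rcases hNB.eq_or_lt with h0 | hNB'
  · rw [← h0, Real.zero_rpow (by positivity), add_zero]
    exact Real.rpow_le_rpow hNA (hN.mono (hA.cfc_rpow q) (Matrix.monotoneOn_cfc_rpow hq hA0
      (add_nonneg hA0 hB0) (le_add_of_nonneg_right hB0))) hqinv
  set a := N (cfc (fun x : ℝ => x ^ q) A) ^ (1 / q) with ha_def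
  set b := N (cfc (fun x : ℝ => x ^ q) B) ^ (1 / q) with hb_def
  have ha : 0 < a := Real.rpow_pos_of_pos hNA' _
  have hb : 0 < b := Real.rpow_pos_of_pos hNB' _
  have normalize {X : Matrix k k ℂ} (hX : X.PosSemidef) {x : ℝ} (hx : 0 < x)
      (h : x = N (cfc (fun x : ℝ => x ^ q) X) ^ (1 / q)) :
      N (cfc (fun x : ℝ => x ^ q) (x⁻¹ • X)) = 1 := by
    rw [hX.cfc_rpow_smul hq0.le (by positivity), hN.2.1 _ (by positivity) _ (hX.cfc_rpow q),
      Real.inv_rpow hx.le]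
    have : x ^ q = N (cfc (fun x : ℝ => x ^ q) X) := by
      rw [h, one_div, Real.rpow_inv_rpow (hN.1 _ (hX.cfc_rpow q)) hq0.ne']
    rw [← this]
    exact inv_mul_cancel₀ (by positivity)
  have hA' : (a⁻¹ • A).PosSemidef := hA.smul (by positivity)
  have hB' : (b⁻¹ • B).PosSemidef := hB.smul (by positivity)
  have hs : 0 ≤ a / (a + b) := by positivity
  have ht : 0 ≤ b / (a + b) := by positivity
  have hconc := (Matrix.concaveOn_cfc_rpow hq).2 (Matrix.nonneg_iff_posSemidef.2 hA')
    (Matrix.nonneg_iff_posSemidef.2 hB') hs ht (by field_simp)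
  have hcomb : (a / (a + b)) • a⁻¹ • A + (b / (a + b)) • b⁻¹ • B = (a + b)⁻¹ • (A + B) := by
    rw [smul_smul, smul_smul, smul_add]
    congr 2 <;> field_simp
  rw [hcomb] at hconc
  have hPA := (hA'.cfc_rpow q).smul hs
  have hPB := (hB'.cfc_rpow q).smul ht
  have h1 := (hN.2.2.1 _ _ hPA hPB).trans (hN.mono (hPA.add hPB) hconc)
  rw [hN.2.1 _ hs _ (hA'.cfc_rpow q), hN.2.1 _ ht _ (hB'.cfc_rpow q),
    normalize hA ha ha_def, normalize hB hb hb_def, (hA.add hB).cfc_rpow_smul hq0.le (by positivity),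
    hN.2.1 _ (by positivity) _ ((hA.add hB).cfc_rpow q), mul_one, mul_one, ← add_div,
    div_self (by positivity), Real.inv_rpow (by positivity), ← div_eq_inv_mul,
    one_le_div (by positivity)] at h1
  rw [one_div, Real.le_rpow_inv_iff_of_pos (by positivity) (hN.1 _ ((hA.add hB).cfc_rpow q)) hq0]
  exact h1

end IsSymmetricAntiNorm

/-- If `‖·‖_!` is a symmetric anti-norm and `q ∈ (0,1)`, then
`A ↦ ‖A^q‖_!^{1/q}` is again a symmetric anti-norm; in particular it is superadditive. -/
theorem antiNorm_rpow_comp {n : ℕ} (N : Matrix (Fin n) (Fin n) ℂ → ℝ)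
    (hN : IsSymmetricAntiNorm N) (q : ℝ) (hq0 : 0 < q) (hq1 : q < 1) :
    IsSymmetricAntiNorm (fun A : Matrix (Fin n) (Fin n) ℂ =>
        N (cfc (fun x : ℝ => x ^ q) A) ^ (1 / q)) ∧
    ∀ A B : Matrix (Fin n) (Fin n) ℂ, A.PosSemidef → B.PosSemidef →
      N (cfc (fun x : ℝ => x ^ q) A) ^ (1 / q) + N (cfc (fun x : ℝ => x ^ q) B) ^ (1 / q) ≤
        N (cfc (fun x : ℝ => x ^ q) (A + B)) ^ (1 / q) := by
  have hsup := fun A B hA hB => hN.rpow_superadditive (A := A) (B := B) hq0 hq1.le hA hB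
  refine ⟨⟨fun A hA => Real.rpow_nonneg (hN.1 _ (hA.cfc_rpow q)) _, fun c hc A hA => ?_, hsup,
    fun U A hU hA => ?_⟩, hsup⟩
  · dsimp only
    rw [hA.cfc_rpow_smul hq0.le hc, hN.2.1 _ (by positivity) _ (hA.cfc_rpow q),
      Real.mul_rpow (by positivity) (hN.1 _ (hA.cfc_rpow q)), one_div,
      Real.rpow_rpow_inv hc hq0.ne']
  · dsimp only
    rw [hA.cfc_rpow_unitary_conj hq0.le hU, hN.2.2.2 U _ hU (hA.cfc_rpow q)]
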